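/- Let G be a finite connected simple graph with sn(G) ≤ 3. Then cart(G) = sn(G) = dsn(G). -/

import Mathlib

open SimpleGraph

universe u


/-- An egg of a graph `G`: a nonempty set of vertices inducing a connected subgraph. -/
def SimpleGraph.IsEgg {V : Type u} (G : SimpleGraph V) (A : Finset V) : Prop :=
  A.Nonempty ∧ (G.induce (A : Set V)).Connected

/-- A scramble on `G`: a nonempty finite collection of eggs. -/
def SimpleGraph.IsScramble {V : Type u} (G : SimpleGraph V) (S : Finset (Finset V)) : Prop :=
  S.Nonempty ∧ ∀ A ∈ S, G.IsEgg A

/-- The hitting number `h(S)`: the minimum cardinality of a set of vertices meeting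
every egg of `S`. -/
noncomputable def hittingNumber {V : Type u} (S : Finset (Finset V)) : ℕ :=
  sInf {n | ∃ H : Finset V, H.card = n ∧ ∀ A ∈ S, ∃ x ∈ H, x ∈ A}

/-- The number of edges of `G` with one endpoint in `A` and the other outside of `A`. -/
noncomputable def cutSize {V : Type u} (G : SimpleGraph V) (A : Set V) : ℕ :=
  Set.ncard {e : Sym2 V | ∃ u v, e = s(u, v) ∧ G.Adj u v ∧ u ∈ A ∧ v ∉ A}

/-- An egg-cut for a scramble `S`: a vertex subset `A` containing some egg of `S` and
whose complement contains some egg of `S`. -/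
def IsEggCut {V : Type u} (S : Finset (Finset V)) (A : Set V) : Prop :=
  (∃ B ∈ S, (B : Set V) ⊆ A) ∧ (∃ B ∈ S, (B : Set V) ⊆ Aᶜ)

/-- The egg-cut number `e(S)` (in `ℕ∞`): the minimum size of an egg-cut for `S`,
or `⊤` if no egg-cut exists. -/
noncomputable def eggCutNumber {V : Type u} (G : SimpleGraph V) (S : Finset (Finset V)) : ℕ∞ :=
  sInf {n : ℕ∞ | ∃ A : Set V, IsEggCut S A ∧ n = (cutSize G A : ℕ∞)}

/-- The order `‖S‖` of a scramble: the minimum of its hitting number and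
its egg-cut number. -/
noncomputable def scrambleOrder {V : Type u} (G : SimpleGraph V) (S : Finset (Finset V)) : ℕ∞ :=
  min (hittingNumber S : ℕ∞) (eggCutNumber G S)

/-- The scramble number `sn(G)`: the maximum order of a scramble on `G`. -/
noncomputable def scrambleNumber {V : Type u} (G : SimpleGraph V) : ℕ :=
  sSup {n | ∃ S : Finset (Finset V), G.IsScramble S ∧ scrambleOrder G S = (n : ℕ∞)}

/-- A disjoint scramble: a scramble whose eggs are pairwise disjoint. -/
def IsDisjointScramble {V : Type u} (G : SimpleGraph V) (S : Finset (Finset V)) : Prop :=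
  G.IsScramble S ∧ (S : Set (Finset V)).Pairwise fun A B => Disjoint (A : Set V) (B : Set V)

/-- The disjoint scramble number `dsn(G)`: the maximum order of a disjoint scramble on `G`. -/
noncomputable def disjointScrambleNumber {V : Type u} (G : SimpleGraph V) : ℕ :=
  sSup {n | ∃ S : Finset (Finset V), IsDisjointScramble G S ∧ scrambleOrder G S = (n : ℕ∞)}

/-- The carton number `cart(G)`: the minimum size (number of eggs) of a scramble on `G`
whose order equals the scramble number of `G`. -/
noncomputable def cartonNumber {V : Type u} (G : SimpleGraph V) : ℕ :=
  sInf {n | ∃ S : Finset (Finset V), G.IsScramble S ∧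
    scrambleOrder G S = (scrambleNumber G : ℕ∞) ∧ S.card = n}

/-- The maximum degree of a graph. -/
noncomputable def maxDeg {V : Type u} (G : SimpleGraph V) : ℕ :=
  sSup {n | ∃ v : V, (G.neighborSet v).ncard = n}

namespace SimpleGraph

variable {V : Type u} {G : SimpleGraph V}

/-- The edge boundary of a vertex set. -/
def boundary (G : SimpleGraph V) (A : Set V) : Set (Sym2 V) :=
  {e | ∃ u v, e = s(u, v) ∧ G.Adj u v ∧ u ∈ A ∧ v ∉ A}

theorem mk_mem_boundary {A : Set V} {u v : V} :
    s(u, v) ∈ G.boundary A ↔ G.Adj u v ∧ (u ∈ A ∧ v ∉ A ∨ v ∈ A ∧ u ∉ A) := by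
  constructor
  · rintro ⟨x, y, h, hxy, hx, hy⟩
    rcases Sym2.eq_iff.1 h with ⟨rfl, rfl⟩ | ⟨rfl, rfl⟩
    · exact ⟨hxy, Or.inl ⟨hx, hy⟩⟩
    · exact ⟨hxy.symm, Or.inr ⟨hx, hy⟩⟩
  · rintro ⟨h, ⟨hu, hv⟩ | ⟨hv, hu⟩⟩
    · exact ⟨u, v, rfl, h, hu, hv⟩
    · exact ⟨v, u, Sym2.eq_swap, h.symm, hv, hu⟩

theorem boundary_compl (A : Set V) : G.boundary Aᶜ = G.boundary A := by
  ext e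
  induction e using Sym2.ind with | _ u v =>
  simp only [mk_mem_boundary, Set.mem_compl_iff]
  tauto

/-- A vertex set is linked if each of its bipartitions into nonempty parts is crossed by an edge. -/
def Linked (G : SimpleGraph V) (A : Set V) : Prop :=
  ∀ U : Set V, ∀ x ∈ A, ∀ y ∈ A, x ∈ U → y ∉ U →
    ∃ u ∈ A, ∃ v ∈ A, u ∈ U ∧ v ∉ U ∧ G.Adj u v

theorem linked_singleton (v : V) : G.Linked {v} := by
  rintro U x rfl y rfl hx hy
  exact absurd hx hy

theorem linked_of_connected_induce {A : Set V} (h : (G.induce A).Connected) : G.Linked A := by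
  intro U x hx y hy hxU hyU
  obtain ⟨p⟩ := h.preconnected ⟨x, hx⟩ ⟨y, hy⟩
  obtain ⟨d, -, h1, h2⟩ := p.exists_boundary_dart {z | (z : V) ∈ U} hxU hyU
  exact ⟨d.fst, d.fst.2, d.snd, d.snd.2, h1, h2, d.adj⟩

theorem Linked.connected_induce {A : Set V} (h : G.Linked A) (hA : A.Nonempty) :
    (G.induce A).Connected := by
  obtain ⟨x, hx⟩ := hA
  rw [connected_iff_exists_forall_reachable]
  refine ⟨⟨x, hx⟩, ?_⟩
  by_contra hcon
  push Not at hcon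
  obtain ⟨⟨y, hy⟩, hxy⟩ := hcon
  obtain ⟨u, hu, v, hv, ⟨hu', hxu⟩, hvU, huv⟩ :=
    h {z | ∃ hz : z ∈ A, (G.induce A).Reachable ⟨x, hx⟩ ⟨z, hz⟩} x hx y hy ⟨hx, Reachable.refl _⟩
      (by rintro ⟨_, h⟩; exact hxy h)
  refine hvU ⟨hv, hxu.trans ?_⟩
  exact Adj.reachable (G := G.induce A) (u := ⟨u, hu⟩) (v := ⟨v, hv⟩) huv

theorem Linked.union {A B : Set V} (hA : G.Linked A) (hB : G.Linked B) {a b : V}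
    (ha : a ∈ A) (hb : b ∈ B) (hab : G.Adj a b) : G.Linked (A ∪ B) := by
  intro U x hx y hy hxU hyU
  have := hA U
  have := hB U
  have := hab.symm
  by_cases a ∈ U <;> by_cases b ∈ U <;> simp only [Set.mem_union] at hx hy ⊢ <;> grind

/-- The component of `v` in the subgraph induced on a finite set `T`. -/
theorem exists_linked_component [Finite V] {T : Set V} {v : V} (hv : v ∈ T) :
    ∃ C ⊆ T, v ∈ C ∧ G.Linked C ∧ ∀ u ∈ C, ∀ w ∈ T, w ∉ C → ¬ G.Adj u w := by
  obtain ⟨C, ⟨hCT, hvC, hC⟩, hmax⟩ :=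
    (Set.toFinite {C : Set V | C ⊆ T ∧ v ∈ C ∧ G.Linked C}).exists_maximal
      ⟨{v}, by simpa using hv, rfl, linked_singleton v⟩
  refine ⟨C, hCT, hvC, hC, fun u hu w hw hwC huw => hwC ?_⟩
  exact hmax (y := C ∪ {w}) ⟨Set.union_subset hCT (by simpa using hw), Or.inl hvC,
    hC.union (linked_singleton w) hu rfl huw⟩ Set.subset_union_left (Or.inr rfl)

/-- A family of linked vertex sets that cannot be hit by fewer than `k` vertices and no two of
which can be separated by fewer than `k` edges. -/
structure IsTangled (G : SimpleGraph V) (k : ℕ) (F : Set (Set V)) : Prop where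
  linked : ∀ E ∈ F, G.Linked E
  nonempty : ∀ E ∈ F, E.Nonempty
  avoid : ∀ H : Set V, H.ncard < k → ∃ E ∈ F, ∀ x ∈ E, x ∉ H
  le_cut : ∀ A : Set V, (∃ E ∈ F, E ⊆ A) → (∃ E ∈ F, E ⊆ Aᶜ) → k ≤ (G.boundary A).ncard

/-- A vertex set with small boundary that contains no member of `F`. -/
def IsSmall (G : SimpleGraph V) (k : ℕ) (F : Set (Set V)) (A : Set V) : Prop :=
  (G.boundary A).ncard < k ∧ ∀ E ∈ F, ¬ E ⊆ A

end SimpleGraph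

namespace SimpleGraph

variable {V : Type u} {G : SimpleGraph V} {k : ℕ} {F : Set (Set V)}

theorem IsSmall.of_subset {A B : Set V} (hB : G.IsSmall k F B) (h : A ⊆ B)
    (hA : (G.boundary A).ncard < k) : G.IsSmall k F A :=
  ⟨hA, fun E hE hEA => hB.2 E hE (hEA.trans h)⟩

theorem IsTangled.isSmall_or_isSmall_compl (hF : G.IsTangled k F) {A : Set V}
    (hA : (G.boundary A).ncard < k) : G.IsSmall k F A ∨ G.IsSmall k F Aᶜ := by
  by_contra! h
  have h1 : ∃ E ∈ F, E ⊆ A := by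
    by_contra! h'
    exact h.1 ⟨hA, h'⟩
  have h2 : ∃ E ∈ F, E ⊆ Aᶜ := by
    by_contra! h'
    exact h.2 ⟨by rwa [boundary_compl], h'⟩
  exact absurd (hF.le_cut A h1 h2) (by omega)

/-- A partition of the vertices into three small sets. -/
structure IsTripartition (G : SimpleGraph V) (k : ℕ) (F : Set (Set V)) (X Y Z : Set V) :
    Prop where
  left : G.IsSmall k F X
  mid : G.IsSmall k F Y
  right : G.IsSmall k F Z
  disjoint_left_mid : Disjoint X Y
  disjoint_mid_right : Disjoint Y Z
  disjoint_right_left : Disjoint Z X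
  cover : X ∪ Y ∪ Z = Set.univ

theorem IsTripartition.rotate {X Y Z : Set V} (h : G.IsTripartition k F X Y Z) :
    G.IsTripartition k F Y Z X :=
  ⟨h.mid, h.right, h.left, h.disjoint_mid_right, h.disjoint_right_left, h.disjoint_left_mid, by
    rw [← h.cover, Set.union_comm, Set.union_assoc]⟩

/-- Three edges joining the parts of a tripartition cyclically, such that
each part has no further boundary edges. -/
structure IsRing (G : SimpleGraph V) (F : Set (Set V)) (X Y Z : Set V) (a b c d e f : V) :
    Prop extends G.IsTripartition 3 F X Y Z where
  a_mem : a ∈ X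
  b_mem : b ∈ X
  c_mem : c ∈ Y
  d_mem : d ∈ Y
  e_mem : e ∈ Z
  f_mem : f ∈ Z
  bc : G.Adj b c
  de : G.Adj d e
  fa : G.Adj f a
  boundary_left : G.boundary X = {s(b, c), s(f, a)}
  boundary_mid : G.boundary Y = {s(d, e), s(b, c)}
  boundary_right : G.boundary Z = {s(f, a), s(d, e)}

theorem IsRing.rotate {X Y Z : Set V} {a b c d e f : V} (h : G.IsRing F X Y Z a b c d e f) :
    G.IsRing F Y Z X c d e f a b :=
  { h.toIsTripartition.rotate with
    a_mem := h.c_mem, b_mem := h.d_mem, c_mem := h.e_mem, d_mem := h.f_mem, e_mem := h.a_mem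
    f_mem := h.b_mem, bc := h.de, de := h.fa, fa := h.bc, boundary_left := h.boundary_mid
    boundary_mid := h.boundary_right, boundary_right := h.boundary_left }

theorem IsTripartition.two_le_ncard {X Y Z : Set V} (h : G.IsTripartition k F X Y Z)
    {b c f a : V} (ha : a ∈ X) (hb : b ∈ X) (hc : c ∈ Y) (hf : f ∈ Z) (hbc : G.Adj b c)
    (hfa : G.Adj f a) :
    {s(b, c), s(f, a)} ⊆ G.boundary X ∧ ({s(b, c), s(f, a)} : Set (Sym2 V)).ncard = 2 := by
  have h1 := Set.disjoint_left.1 h.disjoint_left_mid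
  have h2 := Set.disjoint_left.1 h.disjoint_mid_right
  have h3 := Set.disjoint_left.1 h.disjoint_right_left
  constructor
  · intro e
    simp only [Set.mem_insert_iff, Set.mem_singleton_iff]
    rintro (rfl | rfl) <;> rw [mk_mem_boundary]
    · exact ⟨hbc, Or.inl ⟨hb, fun h => h1 h hc⟩⟩
    · exact ⟨hfa, Or.inr ⟨ha, h3 hf⟩⟩
  · apply Set.ncard_pair
    rw [Ne, Sym2.eq_iff]
    rintro (⟨rfl, rfl⟩ | ⟨rfl, rfl⟩)
    · exact h3 hf hb
    · exact h2 hc hf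

variable [Finite V]

theorem IsTangled.exists_subset_compl (hF : G.IsTangled k F) {A : Set V}
    (hA : G.IsSmall k F A) : ∃ E ∈ F, E ⊆ Aᶜ := by
  classical
  obtain ⟨x₀, -⟩ : ∃ x : V, True := by
    obtain ⟨E, hE, -⟩ := hF.avoid ∅ (by simpa using Nat.zero_lt_of_lt hA.1)
    exact (hF.nonempty E hE).imp fun _ _ => trivial
  let f : Sym2 V → V := fun e => if h : ∃ u ∈ e, u ∈ A then h.choose else x₀
  obtain ⟨E, hE, hEf⟩ := hF.avoid (f '' G.boundary A)
    ((Set.ncard_image_le (Set.toFinite _)).trans_lt hA.1)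
  refine ⟨E, hE, fun x hx hxA => ?_⟩
  obtain ⟨y, hy, hyA⟩ := Set.not_subset.1 (hA.2 E hE)
  obtain ⟨u, hu, v, hv, huA, hvA, huv⟩ := hF.linked E hE A x hx y hy hxA hyA
  refine hEf u hu ⟨s(u, v), ⟨u, v, rfl, huv, huA, hvA⟩, ?_⟩
  have h : ∃ z ∈ s(u, v), z ∈ A := ⟨u, by simp, huA⟩
  have hf : f s(u, v) = h.choose := dif_pos h
  rw [hf]
  obtain ⟨h1, h2⟩ := h.choose_spec
  rcases Sym2.mem_iff.1 h1 with h3 | h3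
  · exact h3
  · rw [h3] at h2
    exact absurd h2 hvA

theorem exists_disjoint_isSmall {A B : Set V} (hA : G.IsSmall k F A) (hB : G.IsSmall k F B) :
    ∃ A' ⊆ A, ∃ B' ⊆ B, G.IsSmall k F A' ∧ G.IsSmall k F B' ∧ Disjoint A' B' ∧
      A' ∪ B' = A ∪ B := by
  have h1 : G.boundary (A \ B) ∪ G.boundary (B \ A) ⊆ G.boundary A ∪ G.boundary B := by
    intro e
    induction e using Sym2.ind with | _ u v =>
    simp only [mk_mem_boundary, Set.mem_union, Set.mem_sdiff]
    tauto
  have h2 : G.boundary (A \ B) ∩ G.boundary (B \ A) ⊆ G.boundary A ∩ G.boundary B := by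
    intro e
    induction e using Sym2.ind with | _ u v =>
    simp only [mk_mem_boundary, Set.mem_inter_iff, Set.mem_sdiff]
    tauto
  have h3 := Set.ncard_le_ncard h1
  have h4 := Set.ncard_le_ncard h2
  have h5 := Set.ncard_union_add_ncard_inter (G.boundary (A \ B)) (G.boundary (B \ A))
  have h6 := Set.ncard_union_add_ncard_inter (G.boundary A) (G.boundary B)
  have h7 := hA.1
  have h8 := hB.1
  by_cases h : (G.boundary (A \ B)).ncard < k
  · exact ⟨A \ B, Set.sdiff_subset, B, subset_rfl, hA.of_subset Set.sdiff_subset h, hB,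
      Set.disjoint_sdiff_left, Set.sdiff_union_self⟩
  · exact ⟨A, subset_rfl, B \ A, Set.sdiff_subset, hA, hB.of_subset Set.sdiff_subset (by omega),
      Set.disjoint_sdiff_right, Set.union_sdiff_self⟩

theorem exists_isTripartition {A B C : Set V} (hA : G.IsSmall k F A) (hB : G.IsSmall k F B)
    (hC : G.IsSmall k F C) (h : A ∪ B ∪ C = Set.univ) :
    ∃ X Y Z, G.IsTripartition k F X Y Z := by
  obtain ⟨A₁, -, B₁, -, hA₁, hB₁, hAB, h₁⟩ := exists_disjoint_isSmall hA hB
  obtain ⟨A₂, hA₂', C₂, -, hA₂, hC₂, hAC, h₂⟩ := exists_disjoint_isSmall hA₁ hC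
  obtain ⟨B₃, hB₃', C₃, hC₃', hB₃, hC₃, hBC, h₃⟩ := exists_disjoint_isSmall hB₁ hC₂
  refine ⟨A₂, B₃, C₃, hA₂, hB₃, hC₃, hAB.mono hA₂' hB₃', hBC, (hAC.mono subset_rfl hC₃').symm, ?_⟩
  rw [Set.union_assoc, h₃, Set.union_comm B₁, ← Set.union_assoc, h₂, ← h, ← h₁,
    Set.union_right_comm]

theorem IsTripartition.exists_adj {X Y Z : Set V} (h : G.IsTripartition k F X Y Z)
    (hF : G.IsTangled k F) : ∃ x ∈ X, ∃ y ∈ Y, G.Adj x y := by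
  obtain ⟨E, hE, hEZ⟩ := hF.exists_subset_compl h.right
  obtain ⟨y, hy, hyX⟩ := Set.not_subset.1 (h.left.2 E hE)
  obtain ⟨x, hx, hxY⟩ := Set.not_subset.1 (h.mid.2 E hE)
  have hmem : ∀ z ∈ E, z ∈ X ∨ z ∈ Y := fun z hz => by
    have h1 : z ∈ X ∪ Y ∪ Z := h.cover ▸ Set.mem_univ z
    exact h1.resolve_right (hEZ hz)
  obtain ⟨u, hu, v, hv, huX, hvX, huv⟩ :=
    hF.linked E hE X x hx y hy ((hmem x hx).resolve_right hxY) hyX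
  exact ⟨u, huX, v, (hmem v hv).resolve_left hvX, huv⟩

theorem IsTripartition.boundary_eq {X Y Z : Set V} (h : G.IsTripartition 3 F X Y Z)
    {b c f a : V} (ha : a ∈ X) (hb : b ∈ X) (hc : c ∈ Y) (hf : f ∈ Z) (hbc : G.Adj b c)
    (hfa : G.Adj f a) : G.boundary X = {s(b, c), s(f, a)} := by
  obtain ⟨h1, h2⟩ := h.two_le_ncard ha hb hc hf hbc hfa
  have h3 := h.left.1
  exact (Set.eq_of_subset_of_ncard_le h1 (by omega)).symm

theorem IsTripartition.exists_isRing {X Y Z : Set V} (h : G.IsTripartition 3 F X Y Z)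
    (hF : G.IsTangled 3 F) : ∃ a b c d e f, G.IsRing F X Y Z a b c d e f := by
  obtain ⟨b, hb, c, hc, hbc⟩ := h.exists_adj hF
  obtain ⟨d, hd, e, he, hde⟩ := h.rotate.exists_adj hF
  obtain ⟨f, hf, a, ha, hfa⟩ := h.rotate.rotate.exists_adj hF
  exact ⟨a, b, c, d, e, f, { h with
    a_mem := ha, b_mem := hb, c_mem := hc, d_mem := hd, e_mem := he, f_mem := hf
    bc := hbc, de := hde, fa := hfa
    boundary_left := h.boundary_eq ha hb hc hf hbc hfa
    boundary_mid := h.rotate.boundary_eq hc hd he hb hde hbc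
    boundary_right := h.rotate.rotate.boundary_eq he hf ha hd hfa hde }⟩

theorem IsTripartition.two_lt (h : ∃ X Y Z, G.IsTripartition k F X Y Z)
    (hF : G.IsTangled k F) : 2 < k := by
  obtain ⟨X, Y, Z, h⟩ := h
  obtain ⟨b, hb, c, hc, hbc⟩ := h.exists_adj hF
  obtain ⟨f, hf, a, ha, hfa⟩ := h.rotate.rotate.exists_adj hF
  obtain ⟨h1, h2⟩ := h.two_le_ncard ha hb hc hf hbc hfa
  have h3 := Set.ncard_le_ncard h1
  have h4 := h.left.1
  omega

theorem ncard_boundary_union_lt {A B : Set V} (hk : k ≤ 3) (hA : (G.boundary A).ncard < k)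
    (hB : (G.boundary B).ncard < k) (hAB : G.Linked (A ∪ B)) (hA₀ : A.Nonempty)
    (hB₀ : B.Nonempty) (h₁ : ¬ A ⊆ B) (h₂ : ¬ B ⊆ A) : (G.boundary (A ∪ B)).ncard < k := by
  obtain ⟨x, hx⟩ := hA₀
  obtain ⟨y, hy⟩ := hB₀
  obtain ⟨x', hx', hxB⟩ := Set.not_subset.1 h₁
  obtain ⟨y', hy', hyA⟩ := Set.not_subset.1 h₂
  obtain ⟨p, hp, q, hq, hpA, hqA, hpq⟩ := hAB A x (Or.inl hx) y' (Or.inr hy') hx hyA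
  obtain ⟨r, hr, s, hs, hrB, hsB, hrs⟩ := hAB B y (Or.inr hy) x' (Or.inl hx') hy hxB
  have h3 : G.boundary (A ∪ B) ⊆ (G.boundary A \ {s(p, q)}) ∪ (G.boundary B \ {s(r, s)}) := by
    intro e he
    have h4 : e ≠ s(p, q) := by
      rintro rfl
      rw [mk_mem_boundary] at he
      tauto
    have h5 : e ≠ s(r, s) := by
      rintro rfl
      rw [mk_mem_boundary] at he
      tauto
    induction e using Sym2.ind with | _ u v =>
    simp only [mk_mem_boundary, Set.mem_union, Set.mem_sdiff, Set.mem_singleton_iff] at he ⊢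
    tauto
  have h4 := Set.ncard_le_ncard h3
  have h5 := Set.ncard_union_le (G.boundary A \ {s(p, q)}) (G.boundary B \ {s(r, s)})
  have h6 := Set.ncard_sdiff_singleton_add_one (s := G.boundary A) (a := s(p, q))
    (mk_mem_boundary.2 ⟨hpq, Or.inl ⟨hpA, hqA⟩⟩)
  have h7 := Set.ncard_sdiff_singleton_add_one (s := G.boundary B) (a := s(r, s))
    (mk_mem_boundary.2 ⟨hrs, Or.inl ⟨hrB, hsB⟩⟩)
  omega

/-- Without tripartitions, the vertices in no small set meet every member of the family. -/
theorem IsTangled.le_ncard_core (hF : G.IsTangled k F) (hk : k ≤ 3)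
    (hno : ¬ ∃ X Y Z, G.IsTripartition k F X Y Z) :
    k ≤ {v | ∀ A, G.IsSmall k F A → v ∉ A}.ncard := by
  by_contra! hlt
  obtain ⟨E, hE, hEK⟩ := hF.avoid _ hlt
  have hcov : ∀ x ∈ E, ∃ C, x ∈ C ∧ G.Linked C ∧ G.IsSmall k F C := by
    intro x hx
    have h1 := hEK x hx
    simp only [Set.mem_ofPred_eq, not_forall, not_not] at h1
    obtain ⟨A, hA, hxA⟩ := h1
    obtain ⟨C, hCA, hxC, hC, hadj⟩ := exists_linked_component (G := G) hxA
    refine ⟨C, hxC, hC, hA.of_subset hCA ((Set.ncard_le_ncard ?_).trans_lt hA.1)⟩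
    rintro e ⟨u, v, rfl, huv, hu, hv⟩
    exact ⟨u, v, rfl, huv, hCA hu, fun hvA => hadj u hu v hvA hv huv⟩
  obtain ⟨x₀, hx₀⟩ := hF.nonempty E hE
  obtain ⟨C₀, hxC₀, hC₀, hC₀s⟩ := hcov x₀ hx₀
  obtain ⟨A, ⟨⟨x, hxA, hxE⟩, hA, hAs⟩, hmax⟩ := (Set.toFinite
    {A : Set V | (∃ x ∈ A, x ∈ E) ∧ G.Linked A ∧ G.IsSmall k F A}).exists_maximal
      ⟨C₀, ⟨x₀, hxC₀, hx₀⟩, hC₀, hC₀s⟩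
  obtain ⟨y, hy, hyA⟩ := Set.not_subset.1 (hAs.2 E hE)
  obtain ⟨u, hu, v, hv, huA, hvA, huv⟩ := hF.linked E hE A x hxE y hy hxA hyA
  obtain ⟨B, hvB, hB, hBs⟩ := hcov v hv
  have hAB := hA.union hB huA hvB huv
  by_cases hAsub : A ⊆ B
  · exact hvA (hmax (y := B) ⟨⟨v, hvB, hv⟩, hB, hBs⟩ hAsub hvB)
  · have hbd := ncard_boundary_union_lt hk hAs.1 hBs.1 hAB ⟨u, huA⟩ ⟨v, hvB⟩ hAsub
      fun h => hvA (h hvB)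
    rcases hF.isSmall_or_isSmall_compl hbd with h | h
    · exact hvA (hmax (y := A ∪ B) ⟨⟨v, Or.inr hvB, hv⟩, hAB, h⟩ Set.subset_union_left
        (Or.inr hvB))
    · exact hno (exists_isTripartition hAs hBs h (Set.union_compl_self _))

end SimpleGraph

namespace SimpleGraph

variable {V : Type u} {G : SimpleGraph V} {F : Set (Set V)}

theorem boundary_subset_of_separated {X U W : Set V} (hX : U ∪ W = X)
    (hUW : ∀ u ∈ U, ∀ w ∈ W, ¬ G.Adj u w) : G.boundary U ⊆ G.boundary X := by
  subst hX
  rintro e ⟨u, v, rfl, huv, hu, hv⟩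
  refine ⟨u, v, rfl, huv, Or.inl hu, ?_⟩
  rintro (h | h)
  · exact hv h
  · exact hUW u hu v h huv

variable [Finite V]

theorem IsRing.not_separated {X Y Z : Set V} {a b c d e f : V} (h : G.IsRing F X Y Z a b c d e f)
    (hF : G.IsTangled 3 F) {U W : Set V} (hX : U ∪ W = X) (hd : Disjoint U W)
    (hUW : ∀ u ∈ U, ∀ w ∈ W, ¬ G.Adj u w) (haU : a ∈ U) (hbW : b ∈ W) : False := by
  have hbU := boundary_subset_of_separated hX hUW
  have hbW' := boundary_subset_of_separated ((Set.union_comm W U).trans hX)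
    fun w hw u hu huw => hUW u hu w hw huw.symm
  have hUX : U ⊆ X := hX ▸ Set.subset_union_left
  have hWX : W ⊆ X := hX ▸ Set.subset_union_right
  have hU : G.IsSmall 3 F U := h.left.of_subset hUX ((Set.ncard_le_ncard hbU).trans_lt h.left.1)
  have hW : G.IsSmall 3 F W := h.left.of_subset hWX ((Set.ncard_le_ncard hbW').trans_lt h.left.1)
  have h1 := Set.disjoint_left.1 h.disjoint_left_mid
  have h2 := Set.disjoint_left.1 h.disjoint_mid_right
  have h3 := Set.disjoint_left.1 h.disjoint_right_left
  have h4 := Set.disjoint_left.1 hd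
  have hbd : G.boundary (U ∪ Z) ⊆ G.boundary Z := by
    rintro _ ⟨p, q, rfl, hpq, hp, hq⟩
    simp only [Set.mem_union, not_or] at hp hq
    rcases hp with hp | hp
    · have h5 : s(p, q) ∈ G.boundary X := hbU ⟨p, q, rfl, hpq, hp, hq.1⟩
      rw [h.boundary_left] at h5
      simp only [Set.mem_insert_iff, Set.mem_singleton_iff, Sym2.eq_iff] at h5
      rcases h5 with (⟨rfl, rfl⟩ | ⟨rfl, rfl⟩) | (⟨rfl, rfl⟩ | ⟨rfl, rfl⟩)
      · exact absurd hbW (h4 hp)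
      · exact absurd h.c_mem (h1 (hUX hp))
      · exact absurd (hUX hp) (h3 h.f_mem)
      · exact absurd h.f_mem hq.2
    · exact ⟨p, q, rfl, hpq, hp, hq.2⟩
  have hcompl : (U ∪ Z)ᶜ = W ∪ Y := by
    ext z
    have hz : z ∈ X ∪ Y ∪ Z := h.cover ▸ Set.mem_univ z
    have hzX : z ∈ X ↔ z ∈ U ∨ z ∈ W := by rw [← hX, Set.mem_union]
    have := @h1 z
    have := @h2 z
    have := @h3 z
    have := @h4 z
    simp only [Set.mem_compl_iff, Set.mem_union] at hz ⊢
    tauto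
  have hcov := h.cover
  rcases hF.isSmall_or_isSmall_compl ((Set.ncard_le_ncard hbd).trans_lt h.right.1) with hs | hs
  · have ht : G.IsTripartition 3 F W (U ∪ Z) Y := by
      refine ⟨hW, hs, h.mid, ?_, ?_, ?_, ?_⟩
      · exact Set.disjoint_union_right.2 ⟨hd.symm, h.disjoint_right_left.symm.mono_left hWX⟩
      · exact Set.disjoint_union_left.2 ⟨h.disjoint_left_mid.mono_left hUX,
          h.disjoint_mid_right.symm⟩
      · exact h.disjoint_left_mid.symm.mono_right hWX
      · rw [← hcov, ← hX]
        ext z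
        simp only [Set.mem_union]
        tauto
    obtain ⟨p, hp, q, hq, hpq⟩ := ht.exists_adj hF
    rcases hq with hq | hq
    · exact hUW q hq p hp hpq.symm
    · have h5 : s(p, q) ∈ G.boundary X := mk_mem_boundary.2 ⟨hpq, Or.inl ⟨hWX hp, h3 hq⟩⟩
      rw [h.boundary_left] at h5
      simp only [Set.mem_insert_iff, Set.mem_singleton_iff, Sym2.eq_iff] at h5
      rcases h5 with (⟨rfl, rfl⟩ | ⟨rfl, rfl⟩) | (⟨rfl, rfl⟩ | ⟨rfl, rfl⟩)
      · exact h2 h.c_mem hq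
      · exact h1 (hWX hp) h.c_mem
      · exact h3 h.f_mem (hWX hp)
      · exact h4 haU hp
  · rw [hcompl] at hs
    have ht : G.IsTripartition 3 F U (W ∪ Y) Z := by
      refine ⟨hU, hs, h.right, ?_, ?_, ?_, ?_⟩
      · exact Set.disjoint_union_right.2 ⟨hd, h.disjoint_left_mid.mono_left hUX⟩
      · exact Set.disjoint_union_left.2 ⟨h.disjoint_right_left.symm.mono_left hWX,
          h.disjoint_mid_right⟩
      · exact h.disjoint_right_left.mono_right hUX
      · rw [← hcov, ← hX]
        ext z
        simp only [Set.mem_union]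
        tauto
    obtain ⟨p, hp, q, hq, hpq⟩ := ht.exists_adj hF
    rcases hq with hq | hq
    · exact hUW p hp q hq hpq
    · have h5 : s(p, q) ∈ G.boundary X :=
        mk_mem_boundary.2 ⟨hpq, Or.inl ⟨hUX hp, fun h => h1 h hq⟩⟩
      rw [h.boundary_left] at h5
      simp only [Set.mem_insert_iff, Set.mem_singleton_iff, Sym2.eq_iff] at h5
      rcases h5 with (⟨rfl, rfl⟩ | ⟨rfl, rfl⟩) | (⟨rfl, rfl⟩ | ⟨rfl, rfl⟩)
      · exact h4 hp hbW
      · exact h1 (hUX hp) h.c_mem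
      · exact h3 h.f_mem (hUX hp)
      · exact h2 hq h.f_mem

theorem IsRing.linked_left {X Y Z : Set V} {a b c d e f : V} (h : G.IsRing F X Y Z a b c d e f)
    (hF : G.IsTangled 3 F) (hG : G.Linked Set.univ) : G.Linked X := by
  intro U x hx y hy hxU hyU
  by_contra! hcon
  have hsep : ∀ u ∈ X ∩ U, ∀ w ∈ X \ U, ¬ G.Adj u w := fun u hu w hw =>
    hcon u hu.1 w hw.1 hu.2 hw.2
  have hsep' : ∀ u ∈ X \ U, ∀ w ∈ X ∩ U, ¬ G.Adj u w := fun u hu w hw huw =>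
    hsep w hw u hu huw.symm
  have hdisj : Disjoint (X ∩ U) (X \ U) := Set.disjoint_sdiff_inter.symm
  have hempty : ∀ W W' : Set V, W ∪ W' = X → (∀ u ∈ W, ∀ w ∈ W', ¬ G.Adj u w) → W.Nonempty →
      ∃ u v, u ∈ W ∧ v ∉ X ∧ s(u, v) ∈ G.boundary X := by
    rintro W W' hW hs ⟨w, hw⟩
    have hcX : c ∉ X := fun hc => Set.disjoint_left.1 h.disjoint_left_mid hc h.c_mem
    have hWX : W ⊆ X := hW ▸ Set.subset_union_left
    obtain ⟨u, -, v, -, hu, hv, huv⟩ := hG W w trivial c trivial hw fun hc => hcX (hWX hc)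
    have hvX : v ∉ X := by
      rw [← hW]
      rintro (h | h)
      · exact hv h
      · exact hs u hu v h huv
    exact ⟨u, v, hu, hvX, u, v, rfl, huv, hWX hu, hvX⟩
  have hend : ∀ u v, v ∉ X → s(u, v) ∈ G.boundary X → u = b ∨ u = a := by
    intro u v hv huv
    rw [h.boundary_left] at huv
    simp only [Set.mem_insert_iff, Set.mem_singleton_iff, Sym2.eq_iff] at huv
    rcases huv with (⟨rfl, rfl⟩ | ⟨rfl, rfl⟩) | (⟨rfl, rfl⟩ | ⟨rfl, rfl⟩)
    · exact Or.inl rfl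
    · exact absurd h.b_mem hv
    · exact absurd h.a_mem hv
    · exact Or.inr rfl
  by_cases ha : a ∈ U <;> by_cases hb : b ∈ U
  · obtain ⟨u, v, hu, hv, huv⟩ :=
        hempty (X \ U) (X ∩ U) (Set.sdiff_union_inter X U) hsep' ⟨y, hy, hyU⟩
    rcases hend u v hv huv with rfl | rfl
    · exact hu.2 hb
    · exact hu.2 ha
  · exact h.not_separated hF (Set.inter_union_sdiff X U) hdisj hsep ⟨h.a_mem, ha⟩ ⟨h.b_mem, hb⟩
  · exact h.not_separated hF (Set.sdiff_union_inter X U) hdisj.symm hsep'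
      ⟨h.a_mem, ha⟩ ⟨h.b_mem, hb⟩
  · obtain ⟨u, v, hu, hv, huv⟩ :=
        hempty (X ∩ U) (X \ U) (Set.inter_union_sdiff X U) hsep ⟨x, hx, hxU⟩
    rcases hend u v hv huv with rfl | rfl
    · exact hb hu.2
    · exact ha hu.2

/-- A part of a ring splits into two linked halves, containing the two ends, that are joined
by at least two edges. -/
theorem IsRing.exists_split {X Y Z : Set V} {a b c d e f : V} (h : G.IsRing F X Y Z a b c d e f)
    (hF : G.IsTangled 3 F) (hG : G.Linked Set.univ) :
    ∃ P Q : Set V, P ⊆ X ∧ Q ⊆ X ∧ Disjoint P Q ∧ a ∈ P ∧ b ∈ Q ∧ G.Linked P ∧ G.Linked Q ∧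
      ∃ u ∈ P, ∃ q ∈ Q, ∃ q' ∈ Q, q ≠ q' ∧ G.Adj u q ∧ G.Adj u q' := by
  have h1 := Set.disjoint_left.1 h.disjoint_left_mid
  have h2 := Set.disjoint_left.1 h.disjoint_mid_right
  have h3 := Set.disjoint_left.1 h.disjoint_right_left
  have hX := h.linked_left hF hG
  obtain ⟨T, ⟨Y₁, rfl, hYX, hbig, hbd⟩, hmin⟩ := (Set.toFinite {T : Set V | ∃ Y₁, T = Y ∪ Y₁ ∧
      Y₁ ⊆ X ∧ (∃ E ∈ F, E ⊆ T) ∧ (G.boundary T).ncard < 3}).exists_minimal (by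
    have hc : Y ∪ X = Zᶜ := by
      ext z
      have hz : z ∈ X ∪ Y ∪ Z := h.cover ▸ Set.mem_univ z
      have := @h1 z
      have := @h2 z
      have := @h3 z
      simp only [Set.mem_compl_iff, Set.mem_union] at hz ⊢
      tauto
    exact ⟨Y ∪ X, X, rfl, subset_rfl, hc ▸ hF.exists_subset_compl h.right,
      by rw [hc, boundary_compl]; exact h.right.1⟩)
  have hYT : ∀ z ∈ Y₁, z ∉ Y := fun z hz => h1 (hYX hz)
  have heT : e ∉ Y ∪ Y₁ := by
    rintro (he | he)
    · exact h2 he h.e_mem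
    · exact h3 h.e_mem (hYX he)
  have hfT : f ∉ Y ∪ Y₁ := by
    rintro (he | he)
    · exact h2 he h.f_mem
    · exact h3 h.f_mem (hYX he)
  obtain ⟨u, hu, v, hv, huv⟩ : ∃ u ∈ Y₁, ∃ v, v ∉ Y ∪ Y₁ ∧ G.Adj u v := by
    by_cases ha : a ∈ Y₁
    · exact ⟨a, ha, f, hfT, h.fa.symm⟩
    · obtain ⟨E, hE, hET⟩ := hbig
      obtain ⟨y, hyE, hyY⟩ := Set.not_subset.1 (h.mid.2 E hE)
      have hy : y ∈ Y₁ := (hET hyE).resolve_left hyY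
      obtain ⟨u, -, v, hv, hu, hv', huv⟩ := hX Y₁ y (hYX hy) a h.a_mem hy ha
      exact ⟨u, hu, v, fun hvT => hvT.elim (h1 hv) hv', huv⟩
  have hbdT : G.boundary (Y ∪ Y₁) = {s(d, e), s(u, v)} := by
    symm
    refine Set.eq_of_subset_of_ncard_le ?_ ?_ (Set.toFinite _)
    · rintro _ (rfl | rfl)
      · exact ⟨d, e, rfl, h.de, Or.inl h.d_mem, heT⟩
      · exact ⟨u, v, rfl, huv, Or.inr hu, hv⟩
    · rw [Set.ncard_pair]
      · omega
      · intro heq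
        rcases Sym2.eq_iff.1 heq with ⟨h4, -⟩ | ⟨-, h4⟩
        · exact hYT u hu (h4 ▸ h.d_mem)
        · exact h3 h.e_mem (h4 ▸ hYX hu)
  have hleave : ∀ x ∈ Y ∪ Y₁, ∀ y, y ∉ Y ∪ Y₁ → G.Adj x y → x = d ∨ x = u := by
    intro x hx y hy hxy
    have h4 : s(x, y) ∈ G.boundary (Y ∪ Y₁) := ⟨x, y, rfl, hxy, hx, hy⟩
    rw [hbdT] at h4
    simp only [Set.mem_insert_iff, Set.mem_singleton_iff, Sym2.eq_iff] at h4
    rcases h4 with (⟨rfl, rfl⟩ | ⟨rfl, rfl⟩) | (⟨rfl, rfl⟩ | ⟨rfl, rfl⟩)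
    · exact Or.inl rfl
    · exact absurd hx heT
    · exact Or.inr rfl
    · exact absurd hx hv
  have hleaveY : ∀ x ∈ Y, ∀ y, y ∉ Y → G.Adj x y → (x = d ∧ y = e) ∨ (x = c ∧ y = b) := by
    intro x hx y hy hxy
    have h4 : s(x, y) ∈ G.boundary Y := ⟨x, y, rfl, hxy, hx, hy⟩
    rw [h.boundary_mid] at h4
    simp only [Set.mem_insert_iff, Set.mem_singleton_iff, Sym2.eq_iff] at h4
    rcases h4 with (⟨rfl, rfl⟩ | ⟨rfl, rfl⟩) | (⟨rfl, rfl⟩ | ⟨rfl, rfl⟩)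
    · exact Or.inl ⟨rfl, rfl⟩
    · exact absurd h.d_mem hy
    · exact absurd h.c_mem hy
    · exact Or.inr ⟨rfl, rfl⟩
  obtain ⟨E, hE, hEH⟩ := hF.avoid {d, u}
    (by have := Set.ncard_insert_le d {u}; rw [Set.ncard_singleton] at this; omega)
  have hdE : d ∉ E := fun hd => hEH d hd (Or.inl rfl)
  have huE : u ∉ E := fun hu => hEH u hu (Or.inr rfl)
  have hET : E ⊆ Y ∪ Y₁ := by
    obtain ⟨x, hx, hxT⟩ : ∃ x ∈ E, x ∈ Y ∪ Y₁ := by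
      by_contra! hcon
      exact absurd (hF.le_cut _ hbig ⟨E, hE, hcon⟩) (by omega)
    by_contra hcon
    obtain ⟨y, hy, hyT⟩ := Set.not_subset.1 hcon
    obtain ⟨p, hp, q, hq, hpT, hqT, hpq⟩ := hF.linked E hE _ x hx y hy hxT hyT
    rcases hleave p hpT q hqT hpq with rfl | rfl
    · exact hdE hp
    · exact huE hp
  have hb : b ∈ E ∧ b ∈ Y₁ := by
    obtain ⟨y, hyE, hyY⟩ := Set.not_subset.1 (h.mid.2 E hE)
    obtain ⟨x, hxE, hxX⟩ := Set.not_subset.1 (h.left.2 E hE)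
    have hx : x ∈ Y := (hET hxE).resolve_right fun h => hxX (hYX h)
    obtain ⟨p, hp, q, hq, hpT, hqT, hpq⟩ := hF.linked E hE Y x hxE y hyE hx hyY
    rcases hleaveY p hpT q hqT hpq with ⟨rfl, rfl⟩ | ⟨rfl, rfl⟩
    · exact absurd hp hdE
    · exact ⟨hq, (hET hq).resolve_left hqT⟩
  have hbu : b ≠ u := fun hbu => huE (hbu ▸ hb.1)
  obtain ⟨Q, hQY, hbQ, hQ, hQadj⟩ := exists_linked_component (G := G) (T := Y₁ \ {u}) (v := b)
    ⟨hb.2, hbu⟩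
  have hQX : Q ⊆ X := fun z hz => hYX (hQY hz).1
  have huQ : u ∉ Q := fun hu => (hQY hu).2 rfl
  have hQleave : ∀ x ∈ Q, ∀ y, y ∉ Y → y ∉ Q → G.Adj x y → y = u := by
    intro x hx y hyY hyQ hxy
    by_cases hy : y ∈ Y₁
    · by_contra hyu
      exact hQadj x hx y ⟨hy, hyu⟩ hyQ hxy
    · rcases hleave x (Or.inr (hQY hx).1) y (fun h => h.elim hyY hy) hxy with rfl | rfl
      · exact absurd h.d_mem (h1 (hQX hx))
      · exact absurd hx huQ
  have hEQ : E ⊆ Y ∪ Q := by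
    by_contra hcon
    obtain ⟨y, hy, hyT⟩ := Set.not_subset.1 hcon
    simp only [Set.mem_union, not_or] at hyT
    obtain ⟨p, hp, q, hq, hpT, hqT, hpq⟩ := hF.linked E hE (Y ∪ Q) b hb.1 y hy (Or.inr hbQ)
      (fun h => h.elim hyT.1 hyT.2)
    simp only [Set.mem_union, not_or] at hqT
    rcases hpT with hpT | hpT
    · rcases hleaveY p hpT q hqT.1 hpq with ⟨rfl, rfl⟩ | ⟨rfl, rfl⟩
      · exact hdE hp
      · exact hqT.2 hbQ
    · exact huE (hQleave p hpT q hqT.1 hqT.2 hpq ▸ hq)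
  have hbdQ : ¬ (G.boundary (Y ∪ Q)).ncard < 3 := by
    intro hlt
    have h4 : Y ∪ Y₁ ⊆ Y ∪ Q := hmin (y := Y ∪ Q) ⟨Q, rfl, hQX, ⟨E, hE, hEQ⟩, hlt⟩
      (Set.union_subset_union_right _ fun z hz => (hQY hz).1)
    exact (h4 (Or.inr hu)).elim (hYT u hu) huQ
  have htwo : ∃ q ∈ Q, ∃ q' ∈ Q, q ≠ q' ∧ G.Adj u q ∧ G.Adj u q' := by
    by_contra! hcon
    apply hbdQ
    obtain ⟨w, hw⟩ : ∃ w, ∀ q ∈ Q, G.Adj u q → q = w := by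
      by_cases hq : ∃ w ∈ Q, G.Adj u w
      · obtain ⟨w, hwQ, hw⟩ := hq
        refine ⟨w, fun q hq huq => ?_⟩
        by_contra hne
        exact hcon q hq w hwQ hne huq hw
      · exact ⟨u, fun q hqQ huq => absurd ⟨q, hqQ, huq⟩ hq⟩
    have hsub : G.boundary (Y ∪ Q) ⊆ {s(d, e), s(w, u)} := by
      rintro _ ⟨p, q, rfl, hpq, hp, hq⟩
      simp only [Set.mem_union, not_or] at hp hq
      rcases hp with hp | hp
      · rcases hleaveY p hp q hq.1 hpq with ⟨rfl, rfl⟩ | ⟨rfl, rfl⟩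
        · exact Or.inl rfl
        · exact absurd hbQ hq.2
      · obtain rfl := hQleave p hp q hq.1 hq.2 hpq
        rw [hw p hp hpq.symm]
        exact Or.inr rfl
    have h4 := Set.ncard_le_ncard hsub
    have h5 := Set.ncard_insert_le s(d, e) {s(w, u)}
    rw [Set.ncard_singleton] at h5
    omega
  have haQ : a ∉ Q := by
    intro ha
    have h4 := hQleave a ha f (fun hf => h2 hf h.f_mem) (fun hf => h3 h.f_mem (hQX hf)) h.fa.symm
    exact h3 h.f_mem (h4 ▸ hYX hu)
  have hP : G.Linked (X \ Q) := by
    intro U x hx y hy hxU hyU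
    have hQleave' : ∀ x ∈ Q, ∀ y ∈ X, y ∉ Q → G.Adj x y → y = u := fun x hx y hy =>
      hQleave x hx y (h1 hy)
    by_cases huU : u ∈ U
    · obtain ⟨p, hp, q, hq, hpU, hqU, hpq⟩ := hX (U ∪ Q) x hx.1 y hy.1 (Or.inl hxU)
        (fun h => h.elim hyU hy.2)
      simp only [Set.mem_union, not_or] at hqU
      by_cases hpQ : p ∈ Q
      · exact absurd (hQleave' p hpQ q hq hqU.2 hpq ▸ huU) hqU.1
      · exact ⟨p, ⟨hp, hpQ⟩, q, ⟨hq, hqU.2⟩, hpU.resolve_right hpQ, hqU.1, hpq⟩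
    · obtain ⟨p, hp, q, hq, hpU, hqU, hpq⟩ := hX (U \ Q) x hx.1 y hy.1 ⟨hxU, hx.2⟩
        (fun h => hyU h.1)
      by_cases hqQ : q ∈ Q
      · exact absurd (hQleave' q hqQ p hp hpU.2 hpq.symm ▸ hpU.1) huU
      · exact ⟨p, ⟨hp, hpU.2⟩, q, ⟨hq, hqQ⟩, hpU.1, fun h => hqU ⟨h, hqQ⟩, hpq⟩
  exact ⟨X \ Q, Q, Set.sdiff_subset, hQX, Set.disjoint_sdiff_left, ⟨h.a_mem, haQ⟩, hbQ, hP, hQ,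
    u, ⟨hYX hu, huQ⟩, htwo⟩

end SimpleGraph

namespace SimpleGraph

variable {V : Type u} {G : SimpleGraph V}

/-- At least two edges join `A` and `B`. -/
def DoublyJoined (G : SimpleGraph V) (A B : Set V) : Prop :=
  ∃ p ∈ A, ∃ p' ∈ A, ∃ q ∈ B, ∃ q' ∈ B, G.Adj p q ∧ G.Adj p' q' ∧ s(p, q) ≠ s(p', q')

theorem DoublyJoined.symm {A B : Set V} : G.DoublyJoined A B → G.DoublyJoined B A := by
  rintro ⟨p, hp, p', hp', q, hq, q', hq', h1, h2, h3⟩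
  refine ⟨q, hq, q', hq', p, hp, p', hp', h1.symm, h2.symm, ?_⟩
  rwa [Sym2.eq_swap, Sym2.eq_swap (a := q')]

theorem DoublyJoined.three_le_ncard_boundary [Finite V] {A B C U : Set V}
    (hAB : G.DoublyJoined A B) (hAC : G.DoublyJoined A C) (hBC : G.DoublyJoined B C)
    (hC : G.Linked C) (hAC' : Disjoint A C) (hBC' : Disjoint B C) (hA : A ⊆ U) (hB : B ⊆ Uᶜ) :
    3 ≤ (G.boundary U).ncard := by
  obtain ⟨p, hp, p', hp', q, hq, q', hq', h1, h2, h3⟩ := hAB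
  have hthird : ∃ x y, s(x, y) ∈ G.boundary U ∧ (x ∈ C ∨ y ∈ C) := by
    by_cases hx : ∃ x ∈ C, x ∈ U
    · obtain ⟨x, hxC, hxU⟩ := hx
      by_cases hy : ∃ y ∈ C, y ∉ U
      · obtain ⟨y, hyC, hyU⟩ := hy
        obtain ⟨u, hu, v, hv, huU, hvU, huv⟩ := hC U x hxC y hyC hxU hyU
        exact ⟨u, v, mk_mem_boundary.2 ⟨huv, Or.inl ⟨huU, hvU⟩⟩, Or.inl hu⟩
      · push Not at hy
        obtain ⟨b, hb, -, -, c, hc, -, -, hbc, -⟩ := hBC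
        exact ⟨b, c, mk_mem_boundary.2 ⟨hbc, Or.inr ⟨hy c hc, hB hb⟩⟩, Or.inr hc⟩
    · push Not at hx
      obtain ⟨a, ha, -, -, c, hc, -, -, hac, -⟩ := hAC
      exact ⟨a, c, mk_mem_boundary.2 ⟨hac, Or.inl ⟨hA ha, hx c hc⟩⟩, Or.inr hc⟩
  obtain ⟨x, y, hxy, hxyC⟩ := hthird
  have hne : ∀ a ∈ A, ∀ b ∈ B, s(a, b) ≠ s(x, y) := by
    intro a ha b hb heq
    have h4 := Set.disjoint_left.1 hAC' ha
    have h5 := Set.disjoint_left.1 hBC' hb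
    rcases Sym2.eq_iff.1 heq with ⟨rfl, rfl⟩ | ⟨rfl, rfl⟩ <;> tauto
  refine (Set.two_lt_ncard_iff (Set.toFinite _)).2 ⟨s(p, q), s(p', q'), s(x, y), ?_, ?_, hxy, h3,
    hne p hp q hq, hne p' hp' q' hq'⟩
  · exact mk_mem_boundary.2 ⟨h1, Or.inl ⟨hA hp, hB hq⟩⟩
  · have h4 := And.intro (hA hp') (hB hq')
    exact mk_mem_boundary.2 ⟨h2, Or.inl h4⟩

/-- There are `k` pairwise disjoint linked sets, no two of which can be separated by fewer than
`k` edges. -/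
def HasDisjointEggs (G : SimpleGraph V) (k : ℕ) : Prop :=
  ∃ D : Finset (Finset V), D.card = k ∧ (∀ A ∈ D, A.Nonempty ∧ G.Linked (A : Set V)) ∧
    (D : Set (Finset V)).Pairwise (fun A B => Disjoint (A : Set V) (B : Set V)) ∧
    ∀ A ∈ D, ∀ B ∈ D, ∀ U : Set V, (A : Set V) ⊆ U → (B : Set V) ⊆ Uᶜ → k ≤ (G.boundary U).ncard

theorem hasDisjointEggs_three [Finite V] {A B C : Set V} (hA : G.Linked A) (hB : G.Linked B)
    (hC : G.Linked C) (hAB : Disjoint A B) (hBC : Disjoint B C) (hCA : Disjoint C A)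
    (hAB' : G.DoublyJoined A B) (hBC' : G.DoublyJoined B C) (hCA' : G.DoublyJoined C A) :
    G.HasDisjointEggs 3 := by
  classical
  have := Fintype.ofFinite V
  have hA₀ : A.Nonempty := hAB'.imp fun _ h => h.1
  have hB₀ : B.Nonempty := hBC'.imp fun _ h => h.1
  have hC₀ : C.Nonempty := hCA'.imp fun _ h => h.1
  have hne : ∀ {S T : Set V}, S.Nonempty → Disjoint S T → S.toFinset ≠ T.toFinset := by
    rintro S T ⟨x, hx⟩ hST heq
    rw [Set.toFinset_inj] at heq
    exact Set.disjoint_left.1 hST hx (heq ▸ hx)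
  refine ⟨{A.toFinset, B.toFinset, C.toFinset}, ?_, ?_, ?_, ?_⟩
  · exact Finset.card_eq_three.2 ⟨_, _, _, hne hA₀ hAB, hne hA₀ hCA.symm, hne hB₀ hBC, rfl⟩
  · simp only [Finset.mem_insert, Finset.mem_singleton, forall_eq_or_imp, forall_eq,
      Set.toFinset_nonempty, Set.coe_toFinset]
    exact ⟨⟨hA₀, hA⟩, ⟨hB₀, hB⟩, hC₀, hC⟩
  · intro S hS T hT hST
    simp only [Finset.coe_insert, Finset.coe_singleton, Set.mem_insert_iff,
      Set.mem_singleton_iff] at hS hT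
    rcases hS with rfl | rfl | rfl <;> rcases hT with rfl | rfl | rfl <;>
      first
      | exact absurd rfl hST
      | simp only [Set.coe_toFinset]
        first | assumption | (apply Disjoint.symm; assumption)
  · have hself : ∀ {S U : Set V}, S.Nonempty → S ⊆ U → S ⊆ Uᶜ → 3 ≤ (G.boundary U).ncard :=
      fun ⟨x, hx⟩ h1 h2 => absurd (h1 hx) (h2 hx)
    simp only [Finset.mem_insert, Finset.mem_singleton, forall_eq_or_imp, forall_eq,
      Set.coe_toFinset]
    refine ⟨⟨fun U => hself hA₀, fun U h1 h2 => ?_, fun U h1 h2 => ?_⟩,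
      ⟨fun U h1 h2 => ?_, fun U => hself hB₀, fun U h1 h2 => ?_⟩,
      ⟨fun U h1 h2 => ?_, fun U h1 h2 => ?_, fun U => hself hC₀⟩⟩
    · exact hAB'.three_le_ncard_boundary hCA'.symm hBC' hC hCA.symm hBC h1 h2
    · exact hCA'.symm.three_le_ncard_boundary hAB' hBC'.symm hB hAB hBC.symm h1 h2
    · exact hAB'.symm.three_le_ncard_boundary hBC' hCA'.symm hC hBC hCA.symm h1 h2
    · exact hBC'.three_le_ncard_boundary hAB'.symm hCA' hA hAB.symm hCA h1 h2
    · exact hCA'.three_le_ncard_boundary hBC'.symm hAB' hB hBC.symm hAB h1 h2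
    · exact hBC'.symm.three_le_ncard_boundary hCA' hAB'.symm hA hCA hAB.symm h1 h2

theorem IsTangled.hasDisjointEggs_of_core [Finite V] {k : ℕ} {F : Set (Set V)}
    (hF : G.IsTangled k F) (h : k ≤ {v | ∀ A, G.IsSmall k F A → v ∉ A}.ncard) :
    G.HasDisjointEggs k := by
  classical
  have := Fintype.ofFinite V
  rw [Set.ncard_eq_toFinset_card'] at h
  obtain ⟨K, hK, rfl⟩ := Finset.exists_subset_card_eq h
  have hK' : ∀ v ∈ K, ∀ A, G.IsSmall K.card F A → v ∉ A := fun v hv => by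
    simpa using hK hv
  refine ⟨K.image fun v => {v}, ?_, ?_, ?_, ?_⟩
  · exact Finset.card_image_of_injective _ Finset.singleton_injective
  · simp only [Finset.mem_image, forall_exists_index, and_imp, forall_apply_eq_imp_iff₂]
    intro v _
    refine ⟨Finset.singleton_nonempty v, ?_⟩
    rw [Finset.coe_singleton]
    exact linked_singleton v
  · simp only [Finset.coe_image]
    rintro _ ⟨v, -, rfl⟩ _ ⟨w, -, rfl⟩ hvw
    simp only [Finset.coe_singleton, Set.disjoint_singleton]
    rintro rfl
    exact hvw rfl
  · simp only [Finset.mem_image, forall_exists_index, and_imp, forall_apply_eq_imp_iff₂,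
      Finset.coe_singleton, Set.singleton_subset_iff]
    intro v hv w hw U hvU hwU
    by_contra! hlt
    rcases hF.isSmall_or_isSmall_compl hlt with h | h
    · exact hK' v hv U h hvU
    · exact hK' w hw _ h hwU

theorem IsRing.hasDisjointEggs [Finite V] {F : Set (Set V)} {X Y Z : Set V} {a b c d e f : V}
    (h : G.IsRing F X Y Z a b c d e f) (hF : G.IsTangled 3 F) (hG : G.Linked Set.univ) :
    G.HasDisjointEggs 3 := by
  obtain ⟨P₁, Q₁, hP₁X, hQ₁X, hPQ₁, haP, hbQ, hP₁, hQ₁,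
    u₁, hu₁, q₁, hq₁, r₁, hr₁, hne₁, hq₁', hr₁'⟩ :=
    h.exists_split hF hG
  obtain ⟨P₂, Q₂, hP₂Y, hQ₂Y, hPQ₂, hcP, hdQ, hP₂, hQ₂,
    u₂, hu₂, q₂, hq₂, r₂, hr₂, hne₂, hq₂', hr₂'⟩ :=
    h.rotate.exists_split hF hG
  obtain ⟨P₃, Q₃, hP₃Z, hQ₃Z, hPQ₃, heP, hfQ, hP₃, hQ₃,
    u₃, hu₃, q₃, hq₃, r₃, hr₃, hne₃, hq₃', hr₃'⟩ :=
    h.rotate.rotate.exists_split hF hG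
  have hXY := h.disjoint_left_mid
  have hYZ := h.disjoint_mid_right
  have hZX := h.disjoint_right_left
  have hjoin : ∀ {A B : Set V} {u q r : V}, u ∈ A → q ∈ B → r ∈ B → q ≠ r → G.Adj u q →
      G.Adj u r → G.DoublyJoined A B := fun hu hq hr hne h1 h2 =>
    ⟨_, hu, _, hu, _, hq, _, hr, h1, h2, fun heq => hne (Sym2.congr_right.1 heq)⟩
  refine hasDisjointEggs_three (A := Q₁ ∪ P₂) (B := Q₂ ∪ P₃) (C := Q₃ ∪ P₁)
    (hQ₁.union hP₂ hbQ hcP h.bc) (hQ₂.union hP₃ hdQ heP h.de) (hQ₃.union hP₁ hfQ haP h.fa)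
    ?_ ?_ ?_ (hjoin (Or.inr hu₂) (Or.inl hq₂) (Or.inl hr₂) hne₂ hq₂' hr₂')
    (hjoin (Or.inr hu₃) (Or.inl hq₃) (Or.inl hr₃) hne₃ hq₃' hr₃')
    (hjoin (Or.inr hu₁) (Or.inl hq₁) (Or.inl hr₁) hne₁ hq₁' hr₁') <;>
    simp only [Set.disjoint_union_left, Set.disjoint_union_right]
  · exact ⟨⟨hXY.mono hQ₁X hQ₂Y, hPQ₂⟩, hZX.symm.mono hQ₁X hP₃Z, hYZ.mono hP₂Y hP₃Z⟩
  · exact ⟨⟨hYZ.mono hQ₂Y hQ₃Z, hPQ₃⟩, hXY.symm.mono hQ₂Y hP₁X, hZX.mono hP₃Z hP₁X⟩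
  · exact ⟨⟨hZX.mono hQ₃Z hQ₁X, hPQ₁⟩, hYZ.symm.mono hQ₃Z hP₂Y, hXY.mono hP₁X hP₂Y⟩

theorem IsTangled.hasDisjointEggs [Finite V] {k : ℕ} {F : Set (Set V)} (hF : G.IsTangled k F)
    (hk : k ≤ 3) (hG : G.Linked Set.univ) : G.HasDisjointEggs k := by
  by_cases hT : ∃ X Y Z, G.IsTripartition k F X Y Z
  · obtain rfl : k = 3 := hk.antisymm (IsTripartition.two_lt hT hF)
    obtain ⟨X, Y, Z, hT⟩ := hT
    obtain ⟨a, b, c, d, e, f, h⟩ := hT.exists_isRing hF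
    exact h.hasDisjointEggs hF hG
  · exact hF.hasDisjointEggs_of_core (hF.le_ncard_core hk hT)

theorem IsScramble.isTangled {S : Finset (Finset V)} (hS : G.IsScramble S) {k : ℕ}
    [Finite V] (hk : (k : ℕ∞) ≤ scrambleOrder G S) :
    G.IsTangled k {E | ∃ A ∈ S, (A : Set V) = E} := by
  classical
  have := Fintype.ofFinite V
  obtain ⟨h1, h2⟩ := le_min_iff.1 hk
  refine ⟨?_, ?_, ?_, ?_⟩
  · rintro _ ⟨A, hA, rfl⟩
    exact linked_of_connected_induce (hS.2 A hA).2
  · rintro _ ⟨A, hA, rfl⟩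
    exact (hS.2 A hA).1
  · intro H hH
    by_contra! hcon
    rw [Set.ncard_eq_toFinset_card'] at hH
    have h3 : hittingNumber S ≤ H.toFinset.card := Nat.sInf_le ⟨H.toFinset, rfl, fun A hA => by
      obtain ⟨x, hx, hxH⟩ := hcon _ ⟨A, hA, rfl⟩
      exact ⟨x, by simpa using hxH, hx⟩⟩
    have h4 : k ≤ hittingNumber S := by exact_mod_cast h1
    omega
  · rintro U ⟨_, ⟨A, hA, rfl⟩, hAU⟩ ⟨_, ⟨B, hB, rfl⟩, hBU⟩
    have h3 : eggCutNumber G S ≤ (cutSize G U : ℕ∞) :=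
      sInf_le ⟨U, ⟨⟨A, hA, hAU⟩, B, hB, hBU⟩, rfl⟩
    exact_mod_cast h2.trans h3

theorem IsScramble.nonempty_vertices {S : Finset (Finset V)} (hS : G.IsScramble S) :
    Nonempty V := by
  obtain ⟨A, hA⟩ := hS.1
  exact (hS.2 A hA).1.elim fun x _ => ⟨x⟩

theorem IsScramble.hittingNumber_le_card {S : Finset (Finset V)} (hS : G.IsScramble S) :
    hittingNumber S ≤ S.card := by
  classical
  have := hS.nonempty_vertices
  choose! g hg using fun A hA => (hS.2 A hA).1
  have h : hittingNumber S ≤ (S.image g).card :=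
    Nat.sInf_le ⟨_, rfl, fun A hA => ⟨g A, Finset.mem_image_of_mem g hA, hg A hA⟩⟩
  exact h.trans Finset.card_image_le

theorem _root_.IsDisjointScramble.card_le_hittingNumber {S : Finset (Finset V)}
    (hS : IsDisjointScramble G S) : S.card ≤ hittingNumber S := by
  classical
  have := hS.1.nonempty_vertices
  choose! g hg using fun A hA => (hS.1.2 A hA).1
  obtain ⟨H, hH, hHS⟩ : hittingNumber S ∈
      {n | ∃ H : Finset V, H.card = n ∧ ∀ A ∈ S, ∃ x ∈ H, x ∈ A} :=
    Nat.sInf_mem ⟨_, S.image g, rfl, fun A hA => ⟨g A, Finset.mem_image_of_mem g hA, hg A hA⟩⟩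
  rw [← hH]
  choose! t ht using hHS
  refine Finset.card_le_card_of_injOn t (fun A hA => (ht A hA).1) fun A hA B hB hAB => ?_
  by_contra hne
  exact Set.disjoint_left.1 (hS.2 hA hB hne) (ht A hA).2 (hAB ▸ (ht B hB).2)

theorem HasDisjointEggs.exists_isDisjointScramble {k : ℕ} (hk : 0 < k)
    (h : G.HasDisjointEggs k) :
    ∃ D : Finset (Finset V), IsDisjointScramble G D ∧ D.card = k ∧ scrambleOrder G D = k := by
  obtain ⟨D, rfl, hegg, hdisj, hcut⟩ := h
  have hD : IsDisjointScramble G D := ⟨⟨Finset.card_pos.1 hk, fun A hA =>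
    ⟨(hegg A hA).1, (hegg A hA).2.connected_induce (hegg A hA).1⟩⟩, hdisj⟩
  refine ⟨D, hD, rfl, ?_⟩
  have h1 : hittingNumber D = D.card := hD.1.hittingNumber_le_card.antisymm hD.card_le_hittingNumber
  have h2 : (D.card : ℕ∞) ≤ eggCutNumber G D := by
    apply le_sInf
    rintro _ ⟨U, ⟨⟨A, hA, hAU⟩, B, hB, hBU⟩, rfl⟩
    exact_mod_cast hcut A hA B hB U hAU hBU
  rw [scrambleOrder, h1, min_eq_left h2]

theorem bddAbove_scrambleOrder [Fintype V] :
    BddAbove {n : ℕ | ∃ S : Finset (Finset V), G.IsScramble S ∧ scrambleOrder G S = n} := by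
  refine ⟨Fintype.card V, ?_⟩
  rintro n ⟨S, hS, hn⟩
  have h1 : hittingNumber S ≤ Fintype.card V := Nat.sInf_le ⟨Finset.univ, rfl, fun A hA => by
    obtain ⟨x, hx⟩ := (hS.2 A hA).1
    exact ⟨x, Finset.mem_univ x, hx⟩⟩
  have h2 : (n : ℕ∞) ≤ hittingNumber S := hn ▸ min_le_left _ _
  have h3 : n ≤ hittingNumber S := by exact_mod_cast h2
  exact h3.trans h1

theorem Connected.linked_univ (hG : G.Connected) : G.Linked Set.univ := by
  intro U x _ y _ hxU hyU
  obtain ⟨p⟩ := hG.preconnected x y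
  obtain ⟨d, -, h1, h2⟩ := p.exists_boundary_dart U hxU hyU
  exact ⟨d.fst, trivial, d.snd, trivial, h1, h2, d.adj⟩

theorem Connected.hasDisjointEggs_one [Fintype V] (hG : G.Connected) : G.HasDisjointEggs 1 := by
  obtain ⟨x⟩ := hG.nonempty
  refine ⟨{Finset.univ}, rfl, ?_, ?_, ?_⟩
  · simp only [Finset.mem_singleton, forall_eq, Finset.coe_univ]
    exact ⟨⟨x, Finset.mem_univ x⟩, hG.linked_univ⟩
  · simp
  · simp only [Finset.mem_singleton, forall_eq, Finset.coe_univ]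
    exact fun U h1 h2 => absurd (h1 (Set.mem_univ x)) (h2 (Set.mem_univ x))

end SimpleGraph

/-- For every finite connected simple graph `G` with `sn(G) ≤ 3`,
we have `cart(G) = sn(G) = dsn(G)`. -/
theorem carton_eq_sn_eq_dsn_of_sn_le_three {V : Type u} [Fintype V] (G : SimpleGraph V)
    (hconn : G.Connected) (hsn : scrambleNumber G ≤ 3) :
    cartonNumber G = scrambleNumber G ∧ scrambleNumber G = disjointScrambleNumber G := by
  have hbdd := bddAbove_scrambleOrder (G := G)
  obtain ⟨D₁, hD₁, -, hord₁⟩ := hconn.hasDisjointEggs_one.exists_isDisjointScramble one_pos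
  have hpos : 0 < scrambleNumber G := le_csSup hbdd ⟨D₁, hD₁.1, hord₁⟩
  obtain ⟨S, hS, hord⟩ : scrambleNumber G ∈
      {n : ℕ | ∃ S : Finset (Finset V), G.IsScramble S ∧ scrambleOrder G S = n} :=
    Nat.sSup_mem ⟨1, D₁, hD₁.1, hord₁⟩ hbdd
  obtain ⟨D, hD, hcard, hordD⟩ :=
    ((hS.isTangled hord.ge).hasDisjointEggs hsn hconn.linked_univ).exists_isDisjointScramble hpos
  have hsub : {n : ℕ | ∃ S : Finset (Finset V), IsDisjointScramble G S ∧ scrambleOrder G S = n} ⊆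
      {n : ℕ | ∃ S : Finset (Finset V), G.IsScramble S ∧ scrambleOrder G S = n} :=
    fun n ⟨S, hS, hn⟩ => ⟨S, hS.1, hn⟩
  constructor
  · apply le_antisymm
    · exact Nat.sInf_le ⟨D, hD.1, hordD, hcard⟩
    · refine le_csInf ⟨_, D, hD.1, hordD, hcard⟩ ?_
      rintro _ ⟨T, hT, hordT, rfl⟩
      have h1 : (scrambleNumber G : ℕ∞) ≤ hittingNumber T := hordT ▸ min_le_left _ _
      have h2 : scrambleNumber G ≤ hittingNumber T := by exact_mod_cast h1
      exact h2.trans hT.hittingNumber_le_card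
  · apply le_antisymm
    · exact le_csSup (hbdd.mono hsub) ⟨D, hD, hordD⟩
    · exact csSup_le_csSup hbdd ⟨_, D, hD, hordD⟩ hsub
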